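/- arXiv:2205.04543 — 8 statements merged into one kernel-verified Lean document; each statement's English description precedes it below -/
import Mathlib

section
/- Let (E, ‖·‖_E) be a normed space equipped with a family {‖·‖_i}_{i∈I} of semi-norms such that (A1) ‖x‖_E = sup_{i∈I} ‖x‖_i for all x ∈ E, and (A2) for every i, j ∈ I there is k ∈ I with ‖x‖_i ≤ ‖x‖_k and ‖x‖_j ≤ ‖x‖_k for all x ∈ E. Then a non-empty subset A of E is precompact (totally bounded) if and only if (i) the algebraic difference A − A is equinormed with respect to {‖·‖_i}_{i∈I}, and (ii) every sequence of elements of A has a subsequence which is Cauchy with respect to each semi-norm ‖·‖_i. -/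
open Pointwise

/-- A sequence in a totally bounded set has a Cauchy subsequence. -/
theorem TotallyBounded.exists_cauchySeq_subseq {X : Type*} [PseudoMetricSpace X] {s : Set X}
    (hs : TotallyBounded s) {u : ℕ → X} (hu : ∀ n, u n ∈ s) :
    ∃ σ : ℕ → ℕ, StrictMono σ ∧ CauchySeq (u ∘ σ) := by
  have hK : IsCompact (_root_.closure ((↑) '' s : Set (UniformSpace.Completion X))) :=
    (hs.image (UniformSpace.Completion.uniformContinuous_coe X)).closure.isCompact_of_isClosed
      isClosed_closure
  obtain ⟨a, -, σ, hσ, h⟩ := hK.tendsto_subseq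
    (x := fun n => (u n : UniformSpace.Completion X))
    fun n => subset_closure (Set.mem_image_of_mem _ (hu n))
  exact ⟨σ, hσ, (UniformSpace.Completion.isUniformInducing_coe X).cauchy_map_iff.1 h.cauchySeq⟩

/-- A set in which every sequence has a Cauchy subsequence is totally bounded. -/
theorem totallyBounded_of_forall_exists_cauchySeq_subseq {X : Type*} [PseudoMetricSpace X]
    {s : Set X} (h : ∀ u : ℕ → X, (∀ n, u n ∈ s) →
      ∃ σ : ℕ → ℕ, StrictMono σ ∧ CauchySeq (u ∘ σ)) :
    TotallyBounded s := by
  rw [Metric.totallyBounded_iff]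
  by_contra! hs
  obtain ⟨ε, hε, hs⟩ := hs
  obtain ⟨u, hu, hsep⟩ := exists_seq_of_forall_finset_exists (· ∈ s)
    (fun x y => ε ≤ dist y x) fun t _ => by
      obtain ⟨y, hy, hyt⟩ := Set.not_subset.1 (hs t t.finite_toSet)
      exact ⟨y, hy, by simpa using hyt⟩
  obtain ⟨σ, hσ, hc⟩ := h u hu
  obtain ⟨N, hN⟩ := Metric.cauchySeq_iff'.1 hc ε hε
  exact (hN (N + 1) N.le_succ).not_ge (hsep _ _ (hσ N.lt_succ_self))

/-- The algebraic difference of a totally bounded set with itself is equinormed with respect to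
every directed family of seminorms whose supremum is the norm. -/
theorem TotallyBounded.exists_norm_le_add_seminorm {E : Type*} [NormedAddCommGroup E]
    [NormedSpace ℝ E] {I : Type*} {p : I → Seminorm ℝ E}
    (hp : ∀ x : E, IsLUB (Set.range fun i : I => p i x) ‖x‖) (hdir : Directed (· ≤ ·) p)
    {A : Set E} (hA : TotallyBounded A) {ε : ℝ} (hε : 0 < ε) :
    ∃ k : I, ∀ x ∈ A - A, ‖x‖ ≤ ε + p k x := by
  classical
  have : Nonempty I := by
    by_contra hI
    rw [not_nonempty_iff] at hI
    have h := hp 0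
    rw [Set.range_eq_empty, isLUB_empty_iff] at h
    exact not_isBot _ h
  obtain ⟨t, ht, hAt⟩ := Metric.totallyBounded_iff.1 hA (ε / 5) (by positivity)
  have hnear : ∀ y : E, ∃ i, ‖y‖ - ε / 5 < p i y := fun y => by
    obtain ⟨_, ⟨i, rfl⟩, hi, -⟩ := (hp y).exists_between (b := ‖y‖ - ε / 5) (by linarith)
    exact ⟨i, hi⟩
  choose i hi using hnear
  obtain ⟨k, hk⟩ := hdir.finset_le ((ht.sub ht).toFinset.image i)
  refine ⟨k, ?_⟩
  rintro _ ⟨a, ha, b, hb, rfl⟩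
  obtain ⟨c, hc, hac⟩ := Set.mem_iUnion₂.1 (hAt ha)
  obtain ⟨d, hd, hbd⟩ := Set.mem_iUnion₂.1 (hAt hb)
  rw [Metric.mem_ball, dist_eq_norm] at hac hbd
  have hdiff : ‖(a - b) - (c - d)‖ < 2 * (ε / 5) := by
    calc ‖(a - b) - (c - d)‖ = ‖(a - c) - (b - d)‖ := by congr 1; abel
      _ ≤ ‖a - c‖ + ‖b - d‖ := norm_sub_le _ _
      _ < 2 * (ε / 5) := by linarith
  have hkcd : p (i (c - d)) (c - d) ≤ p k (c - d) :=
    hk _ (Finset.mem_image_of_mem _ (by simpa using Set.sub_mem_sub hc hd)) _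
  have hnorm : ‖a - b‖ ≤ ‖c - d‖ + ‖(a - b) - (c - d)‖ := norm_le_norm_add_norm_sub' _ _
  have hsemi : p k (c - d) ≤ p k (a - b) + p k ((a - b) - (c - d)) := by
    simpa using map_sub_le_add (p k) (a - b) ((a - b) - (c - d))
  have hle : p k ((a - b) - (c - d)) ≤ ‖(a - b) - (c - d)‖ := (hp _).1 ⟨k, rfl⟩
  linarith [hi (c - d)]

/-- **Abstract compactness criterion.**
Let `E` be a normed space equipped with a family `{p i}` of semi-norms such that
(A1) `‖x‖ = sup_i p i x` for all `x`, and (A2) the family is directed.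
Then a non-empty subset `A` of `E` is precompact (totally bounded) if and only if
(i) `A - A` is equinormed with respect to the family, and
(ii) every sequence of elements of `A` has a subsequence which is Cauchy with
respect to each semi-norm `p i`. -/
theorem stmt_0 {E : Type*} [NormedAddCommGroup E] [NormedSpace ℝ E]
    {I : Type*} (p : I → Seminorm ℝ E)
    (hA1 : ∀ x : E, IsLUB (Set.range fun i : I => p i x) ‖x‖)
    (hA2 : ∀ i j : I, ∃ k : I, ∀ x : E, p i x ≤ p k x ∧ p j x ≤ p k x)
    (A : Set E) (hA : A.Nonempty) :
    TotallyBounded A ↔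
      ((∀ ε : ℝ, 0 < ε → ∃ k : I, ∀ x ∈ A - A, ‖x‖ ≤ ε + p k x) ∧
       (∀ u : ℕ → E, (∀ n, u n ∈ A) →
         ∃ σ : ℕ → ℕ, StrictMono σ ∧
           ∀ i : I, ∀ ε : ℝ, 0 < ε → ∃ N : ℕ, ∀ m ≥ N, ∀ n ≥ N,
             p i (u (σ m) - u (σ n)) ≤ ε)) := by
  constructor
  · intro h
    refine ⟨fun ε hε => h.exists_norm_le_add_seminorm hA1 (fun i j => ?_) hε, fun u hu => ?_⟩
    · obtain ⟨k, hk⟩ := hA2 i j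
      exact ⟨k, fun x => (hk x).1, fun x => (hk x).2⟩
    · obtain ⟨σ, hσ, hc⟩ := h.exists_cauchySeq_subseq hu
      refine ⟨σ, hσ, fun i ε hε => ?_⟩
      obtain ⟨N, hN⟩ := Metric.cauchySeq_iff.1 hc ε hε
      refine ⟨N, fun m hm n hn => ((hA1 _).1 ⟨i, rfl⟩).trans ?_⟩
      rw [← dist_eq_norm]
      exact (hN m hm n hn).le
  · rintro ⟨hequi, hseq⟩
    refine totallyBounded_of_forall_exists_cauchySeq_subseq fun u hu => ?_
    obtain ⟨σ, hσ, hc⟩ := hseq u hu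
    refine ⟨σ, hσ, Metric.cauchySeq_iff.2 fun ε hε => ?_⟩
    obtain ⟨k, hk⟩ := hequi (ε / 3) (by positivity)
    obtain ⟨N, hN⟩ := hc k (ε / 3) (by positivity)
    refine ⟨N, fun m hm n hn => ?_⟩
    rw [dist_eq_norm]
    have := hk _ (Set.sub_mem_sub (hu (σ m)) (hu (σ n)))
    have := hN m hm n hn
    simp only [Function.comp_apply]
    linarith
end

section
/- Let X be a non-empty set and (E, ‖·‖_E) a normed space. A non-empty subset A of B(X,E) is precompact if and only if the algebraic difference A − A satisfies the condition (B) and for every x ∈ X the section A(x) is precompact in E. -/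
open Pointwise

/-- Condition (B) for a set of (bounded) functions: for every `ε > 0` there is a finite
cover `U_1, …, U_N` of `X` such that `|‖f x‖ - ‖f y‖| ≤ ε` for all `x, y` in the same
`U_i` and all `f` in the set. -/
def CondB {X E : Type*} [TopologicalSpace X] [NormedAddCommGroup E]
    (S : Set (BoundedContinuousFunction X E)) : Prop :=
  ∀ ε : ℝ, 0 < ε → ∃ (N : ℕ) (U : Fin N → Set X),
    (⋃ i, U i) = Set.univ ∧
    ∀ i : Fin N, ∀ x ∈ U i, ∀ y ∈ U i, ∀ f ∈ S, |‖f x‖ - ‖f y‖| ≤ ε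

open BoundedContinuousFunction in
theorem TotallyBounded.condB_sub {X E : Type*} [TopologicalSpace X] [NormedAddCommGroup E]
    {A : Set (X →ᵇ E)} (h : TotallyBounded A) : CondB (A - A) := by
  intro ε hε
  obtain ⟨t, ht, hAt⟩ := Metric.totallyBounded_iff.1 h (ε / 6) (by positivity)
  have := ht.fintype
  let v : X → t × t → ℝ := fun x p => ‖p.1.1 x - p.2.1 x‖
  have hv : TotallyBounded (Set.range v) := by
    refine (isCompact_Icc (a := (0 : t × t → ℝ))
      (b := fun p => ‖p.1.1 - p.2.1‖)).totallyBounded.subset ?_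
    rintro _ ⟨x, rfl⟩
    exact ⟨fun p => norm_nonneg _, fun p => (p.1.1 - p.2.1).norm_coe_le_norm x⟩
  obtain ⟨c, hc, hvc⟩ := Metric.totallyBounded_iff.1 hv (ε / 6) (by positivity)
  have := hc.fintype
  let e := Fintype.equivFin c
  refine ⟨Fintype.card c, fun i => v ⁻¹' Metric.ball (e.symm i).1 (ε / 6), ?_, ?_⟩
  · refine Set.eq_univ_of_forall fun x => ?_
    obtain ⟨y, hy, hxy⟩ := Set.mem_iUnion₂.1 (hvc ⟨x, rfl⟩)
    exact Set.mem_iUnion.2 ⟨e ⟨y, hy⟩, by simpa using hxy⟩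
  · rintro i x hx y hy _ ⟨f, hf, g, hg, rfl⟩
    obtain ⟨f', hf', hff'⟩ := Set.mem_iUnion₂.1 (hAt hf)
    obtain ⟨g', hg', hgg'⟩ := Set.mem_iUnion₂.1 (hAt hg)
    have key (z : X) : |‖f z - g z‖ - v z (⟨f', hf'⟩, ⟨g', hg'⟩)| ≤ ε / 3 := by
      have h1 : dist (f z) (f' z) ≤ ε / 6 := (dist_coe_le_dist z).trans hff'.le
      have h2 : dist (g z) (g' z) ≤ ε / 6 := (dist_coe_le_dist z).trans hgg'.le
      rw [← dist_eq_norm, show v z (⟨f', hf'⟩, ⟨g', hg'⟩) = dist (f' z) (g' z) from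
        (dist_eq_norm _ _).symm, ← Real.dist_eq]
      exact (dist_dist_dist_le _ _ _ _).trans (by linarith)
    have hxy : |v x (⟨f', hf'⟩, ⟨g', hg'⟩) - v y (⟨f', hf'⟩, ⟨g', hg'⟩)| ≤ ε / 3 := by
      rw [← Real.dist_eq]
      refine (dist_le_pi_dist (v x) (v y) _).trans ?_
      have := dist_triangle_right (v x) (v y) (e.symm i).1
      have h1 : dist (v x) (e.symm i).1 < ε / 6 := hx
      have h2 : dist (v y) (e.symm i).1 < ε / 6 := hy
      linarith
    have hx' := abs_le.1 (key x)
    have hy' := abs_le.1 (key y)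
    have hxy' := abs_le.1 hxy
    simp only [BoundedContinuousFunction.sub_apply]
    exact abs_le.2 ⟨by linarith, by linarith⟩

open BoundedContinuousFunction in
theorem CondB.totallyBounded {X E : Type*} [Nonempty X] [TopologicalSpace X]
    [NormedAddCommGroup E] {A : Set (X →ᵇ E)} (h : CondB (A - A))
    (hA : ∀ x : X, TotallyBounded ((fun f : X →ᵇ E => f x) '' A)) : TotallyBounded A := by
  refine Metric.totallyBounded_of_finite_discretization fun ε hε => ?_
  obtain ⟨N, U, hU, hUA⟩ := h (ε / 4) (by positivity)
  have hp (i : Fin N) : ∃ p : X, (U i).Nonempty → p ∈ U i := by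
    by_cases hi : (U i).Nonempty
    · exact ⟨hi.some, fun _ => hi.some_mem⟩
    · exact ⟨Classical.arbitrary X, fun h => absurd h hi⟩
  choose p hp using hp
  choose t ht hAt using fun i => Metric.totallyBounded_iff.1 (hA (p i)) (ε / 8) (by positivity)
  have (i : Fin N) : Fintype (t i) := (ht i).fintype
  have hF (f : A) (i : Fin N) : ∃ y : t i, dist (f.1 (p i)) y < ε / 8 := by
    obtain ⟨y, hy, hfy⟩ := Set.mem_iUnion₂.1 (hAt i ⟨f.1, f.2, rfl⟩)
    exact ⟨⟨y, hy⟩, hfy⟩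
  choose F hF using hF
  refine ⟨ULift (∀ i, t i), inferInstance, fun f => ⟨F f⟩, fun f g hfg => ?_⟩
  have hfg : F f = F g := congrArg ULift.down hfg
  refine ((dist_le (by positivity : 0 ≤ ε / 2)).2 fun x => ?_).trans_lt (by linarith)
  obtain ⟨i, hi⟩ := Set.mem_iUnion.1 (hU.symm ▸ Set.mem_univ x)
  have h1 := (abs_le.1 (hUA i x hi (p i) (hp i ⟨x, hi⟩) _ (Set.sub_mem_sub f.2 g.2))).2
  simp only [BoundedContinuousFunction.sub_apply, ← dist_eq_norm] at h1
  have h2 := hF f i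
  have h3 := hF g i
  rw [← hfg] at h3
  have h4 := dist_triangle_right (f.1 (p i)) (g.1 (p i)) (F f i)
  linarith

/-- **Compactness criterion in `B(X,E)`.**  Here `X` is a non-empty set (a discrete
topological space, so that `X →ᵇ E` is exactly the space of bounded maps `X → E` with the
supremum norm).  A non-empty `A ⊆ B(X,E)` is precompact iff `A - A` satisfies condition
(B) and every section `A(x)` is precompact in `E`. -/
theorem stmt_1 {X E : Type*} [Nonempty X] [TopologicalSpace X] [DiscreteTopology X]
    [NormedAddCommGroup E] [NormedSpace ℝ E]
    (A : Set (BoundedContinuousFunction X E)) (hA : A.Nonempty) :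
    TotallyBounded A ↔
      CondB (A - A) ∧
        ∀ x : X, TotallyBounded ((fun f : BoundedContinuousFunction X E => f x) '' A) := by
  exact ⟨fun h => ⟨h.condB_sub, fun x =>
    h.image (BoundedContinuousFunction.lipschitz_eval_const x).uniformContinuous⟩,
    fun h => h.1.totallyBounded h.2⟩
end

section
/- Let X be a non-empty set, (E, ‖·‖_E) a normed space, and A a non-empty subset of B(X,E). Suppose that A − A is equinormed with respect to the family of semi-norms {‖·‖_Y}_{Y∈F}, where F is the family of all non-empty finite subsets of X and ‖f‖_Y := sup_{x∈Y} ‖f(x)‖_E, and that each sequence of elements of A contains a subsequence which is Cauchy with respect to each semi-norm ‖·‖_Y. Then A − A satisfies the condition (B) and the sections A(x) for x ∈ X are precompact. -/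
open Pointwise

/-- A set is totally bounded if each sequence of its elements has a Cauchy subsequence. -/
theorem totallyBounded_of_forall_exists_cauchySeq {M : Type*} [UniformSpace M] {s : Set M}
    (h : ∀ u : ℕ → M, (∀ n, u n ∈ s) → ∃ φ : ℕ → ℕ, StrictMono φ ∧ CauchySeq (u ∘ φ)) :
    TotallyBounded s := by
  intro V hV
  contrapose! h
  obtain ⟨u, hus, hu⟩ : ∃ u : ℕ → M, (∀ n, u n ∈ s) ∧
      ∀ n m, m < n → u m ∉ UniformSpace.ball (u n) V := by
    simp only [Set.not_subset, Set.mem_iUnion₂, not_exists, exists_prop] at h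
    simpa only [forall_and, Set.forall_mem_image, not_and] using! Set.seq_of_forall_finite_exists h
  refine ⟨u, hus, fun φ hφ hc => ?_⟩
  obtain ⟨N, hN⟩ : ∃ N, ∀ p q, p ≥ N → q ≥ N → (u (φ p), u (φ q)) ∈ V := hc.mem_entourage hV
  exact hu (φ (N + 1)) (φ N) (hφ N.lt_add_one) (hN (N + 1) N N.le_succ le_rfl)

theorem TotallyBounded.sub_of_seminormed {G : Type*} [SeminormedAddCommGroup G] {s t : Set G}
    (hs : TotallyBounded s) (ht : TotallyBounded t) : TotallyBounded (s - t) := by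
  rw [Metric.totallyBounded_iff] at *
  intro ε hε
  obtain ⟨a, ha, hsa⟩ := hs (ε / 2) (half_pos hε)
  obtain ⟨b, hb, htb⟩ := ht (ε / 2) (half_pos hε)
  refine ⟨a - b, ha.sub hb, ?_⟩
  rintro _ ⟨x, hx, y, hy, rfl⟩
  obtain ⟨x', hx', hxx'⟩ := Set.mem_iUnion₂.1 (hsa hx)
  obtain ⟨y', hy', hyy'⟩ := Set.mem_iUnion₂.1 (htb hy)
  refine Set.mem_iUnion₂.2 ⟨x' - y', Set.sub_mem_sub hx' hy', ?_⟩
  rw [Metric.mem_ball] at *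
  have := dist_sub_sub_le x y x' y'
  simp only
  linarith

theorem TotallyBounded.condB {X E : Type*} [TopologicalSpace X] [NormedAddCommGroup E]
    {S : Set (BoundedContinuousFunction X E)} (hS : TotallyBounded S) : CondB S := by
  intro ε hε
  have hε4 : 0 < ε / 4 := by positivity
  obtain ⟨t, ht, hSt⟩ := Metric.totallyBounded_iff.1 hS (ε / 4) hε4
  have := ht.fintype
  let Φ : X → t → ℝ := fun x g => ‖g.1 x‖
  have hΦ : TotallyBounded (Set.range Φ) := by
    refine (isCompact_Icc (a := (0 : t → ℝ)) (b := fun g => ‖g.1‖)).totallyBounded.subset ?_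
    rintro _ ⟨x, rfl⟩
    exact ⟨fun g => norm_nonneg _, fun g => g.1.norm_coe_le_norm x⟩
  obtain ⟨c, hc, hΦc⟩ := Metric.totallyBounded_iff.1 hΦ (ε / 4) hε4
  have := hc.fintype
  let e := Fintype.equivFin c
  refine ⟨Fintype.card c, fun i => Φ ⁻¹' Metric.ball (e.symm i).1 (ε / 4), ?_, ?_⟩
  · refine Set.eq_univ_of_forall fun x => ?_
    obtain ⟨v, hv, hxv⟩ := Set.mem_iUnion₂.1 (hΦc ⟨x, rfl⟩)
    exact Set.mem_iUnion.2 ⟨e ⟨v, hv⟩, by simpa using hxv⟩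
  · intro i x hx y hy f hf
    obtain ⟨g, hg, hfg⟩ := Set.mem_iUnion₂.1 (hSt hf)
    have hxy : |‖g x‖ - ‖g y‖| ≤ ε / 4 + ε / 4 := by
      rw [← Real.dist_eq]
      refine (dist_le_pi_dist (Φ x) (Φ y) ⟨g, hg⟩).trans ?_
      exact (dist_triangle_right _ _ _).trans
        (add_le_add (Metric.mem_ball.1 hx).le (Metric.mem_ball.1 hy).le)
    have hnear : ∀ z, |‖f z‖ - ‖g z‖| ≤ ε / 4 := fun z =>
      (abs_norm_sub_norm_le _ _).trans <| by
        rw [← dist_eq_norm]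
        exact (BoundedContinuousFunction.dist_coe_le_dist z).trans (Metric.mem_ball.1 hfg).le
    have hfx := abs_le.1 (hnear x)
    have hfy := abs_le.1 (hnear y)
    rw [abs_le] at hxy ⊢
    constructor <;> linarith

/-- If `A - A` is equinormed with respect to the family of semi-norms
`‖f‖_Y = sup_{x ∈ Y} ‖f x‖` (over non-empty finite `Y ⊆ X`), and every sequence in `A`
has a subsequence which is Cauchy with respect to each semi-norm `‖·‖_Y`, then `A - A`
satisfies condition (B) and all sections `A(x)` are precompact.  (`X` carries the
discrete topology, so `X →ᵇ E` is the space `B(X,E)` of bounded maps.) -/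
theorem stmt_2 {X E : Type*} [Nonempty X] [TopologicalSpace X] [DiscreteTopology X]
    [NormedAddCommGroup E] [NormedSpace ℝ E]
    (A : Set (BoundedContinuousFunction X E)) (hA : A.Nonempty)
    (heq : ∀ ε : ℝ, 0 < ε → ∃ (Y : Finset X) (hY : Y.Nonempty),
      ∀ h ∈ A - A, ‖h‖ ≤ ε + Y.sup' hY fun x => ‖h x‖)
    (hcauchy : ∀ u : ℕ → BoundedContinuousFunction X E, (∀ n, u n ∈ A) →
      ∃ σ : ℕ → ℕ, StrictMono σ ∧
        ∀ (Y : Finset X) (hY : Y.Nonempty), ∀ ε : ℝ, 0 < ε →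
          ∃ N : ℕ, ∀ m ≥ N, ∀ n ≥ N,
            (Y.sup' hY fun x => ‖(u (σ m) - u (σ n)) x‖) ≤ ε) :
    CondB (A - A) ∧
      ∀ x : X, TotallyBounded ((fun f : BoundedContinuousFunction X E => f x) '' A) := by
  have hTB : TotallyBounded A := by
    refine totallyBounded_of_forall_exists_cauchySeq fun u hu => ?_
    obtain ⟨σ, hσ, hc⟩ := hcauchy u hu
    refine ⟨σ, hσ, Metric.cauchySeq_iff.2 fun ε hε => ?_⟩
    obtain ⟨Y, hY, hnorm⟩ := heq (ε / 3) (by positivity)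
    obtain ⟨N, hN⟩ := hc Y hY (ε / 3) (by positivity)
    refine ⟨N, fun m hm n hn => ?_⟩
    have h₁ := hnorm _ (Set.sub_mem_sub (hu (σ m)) (hu (σ n)))
    have h₂ := hN m hm n hn
    rw [Function.comp_apply, Function.comp_apply, dist_eq_norm]
    linarith
  exact ⟨(hTB.sub_of_seminormed hTB).condB, fun x =>
    hTB.image (BoundedContinuousFunction.lipschitz_eval_const x).uniformContinuous⟩
end

section
/- Let X be the set of all zero-one sequences with only finitely many non-zero terms, and let E be an infinite-dimensional normed space. Then there exists a non-empty set A ⊆ B(X,E) such that: (a) A satisfies the condition (B); (b) A − A does not satisfy the condition (B); (c) for each x ∈ X the section A(x) is compact; (d) A(X) := ⋃_{x∈X} A(x) is not precompact; and (e) A is not precompact in B(X,E). -/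
open Pointwise

/-- The set of all zero-one sequences with only finitely many non-zero terms. -/
def ZOSeq : Type := {f : ℕ → ℕ // (∀ n, f n ≤ 1) ∧ {n | f n ≠ 0}.Finite}

/-- `ZOSeq` is regarded as a plain set: we endow it with the discrete topology, so that
`ZOSeq →ᵇ E` is exactly the space `B(X,E)` of bounded maps with the supremum norm. -/
instance : TopologicalSpace ZOSeq := ⊥

instance : DiscreteTopology ZOSeq := ⟨rfl⟩

/-- A totally bounded set contains no infinite sequence of points at mutual distance at
least one. -/
theorem TotallyBounded.not_forall_one_le_dist {α : Type*} [PseudoMetricSpace α] {s : Set α}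
    (hs : TotallyBounded s) {v : ℕ → α} (hv : ∀ n, v n ∈ s) :
    ¬ ∀ m n, m ≠ n → 1 ≤ dist (v m) (v n) := by
  intro hsep
  obtain ⟨t, ht, hst⟩ := Metric.totallyBounded_iff.1 hs (1 / 2) (by norm_num)
  have hball : ∀ n, ∃ y : t, dist (v n) y < 1 / 2 := fun n => by
    simpa using hst (hv n)
  choose c hc using hball
  have := ht.to_subtype
  obtain ⟨m, n, hmn, hcmn⟩ := Finite.exists_ne_map_eq_of_infinite c
  have hm := hc m
  rw [hcmn] at hm
  linarith [hsep m n hmn, hc n, dist_triangle_right (v m) (v n) (c n)]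

/-- A set of functions each of which is either of constant norm or equal to a fixed bounded
function `h` satisfies condition (B). -/
theorem condB_of_forall_norm_eq_or_eq {X E : Type*} [TopologicalSpace X] [NormedAddCommGroup E]
    {S : Set (BoundedContinuousFunction X E)} (h : BoundedContinuousFunction X E)
    (hS : ∀ f ∈ S, (∀ x y, ‖f x‖ = ‖f y‖) ∨ f = h) : CondB S := by
  intro ε hε
  obtain ⟨t, ht, hcover⟩ := Metric.totallyBounded_iff.1
    (isCompact_Icc (a := (0 : ℝ)) (b := ‖h‖)).totallyBounded (ε / 2) (half_pos hε)
  have := ht.fintype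
  let e := Fintype.equivFin t
  refine ⟨Fintype.card t, fun i => {x | dist ‖h x‖ (e.symm i : ℝ) < ε / 2}, ?_, ?_⟩
  · refine Set.eq_univ_of_forall fun x => ?_
    obtain ⟨y, hy, hxy⟩ : ∃ y ∈ t, dist ‖h x‖ y < ε / 2 := by
      simpa using hcover ⟨norm_nonneg (h x), h.norm_coe_le_norm x⟩
    exact Set.mem_iUnion.2 ⟨e ⟨y, hy⟩, by simpa using hxy⟩
  · intro i x hx y hy f hf
    rcases hS f hf with hconst | rfl
    · simpa [hconst x y] using hε.le
    · rw [← Real.dist_eq]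
      have hx' : dist ‖f x‖ (e.symm i : ℝ) < ε / 2 := hx
      have hy' : dist ‖f y‖ (e.symm i : ℝ) < ε / 2 := hy
      linarith [dist_triangle_right ‖f x‖ ‖f y‖ (e.symm i : ℝ)]

namespace ZOSeq

/-- The sequence whose only non-zero term is a one in position `n`. -/
def single (n : ℕ) : ZOSeq :=
  ⟨Pi.single n 1, fun m => by by_cases h : m = n <;> simp [h],
    (Set.finite_singleton n).subset fun m hm => by
      by_contra h
      exact hm (Pi.single_eq_of_ne h 1)⟩

theorem single_val_self (n : ℕ) : (single n).1 n = 1 := Pi.single_eq_same n 1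

theorem single_val_of_ne {m n : ℕ} (h : m ≠ n) : (single n).1 m = 0 := Pi.single_eq_of_ne h 1

theorem single_injective : Function.Injective single := by
  intro m n h
  by_contra hmn
  have := single_val_self m
  rw [h, single_val_of_ne hmn] at this
  exact zero_ne_one this

instance : Infinite ZOSeq := Infinite.of_injective single single_injective

theorem val_eq_zero_or_one (x : ZOSeq) (n : ℕ) : x.1 n = 0 ∨ x.1 n = 1 :=
  Nat.le_one_iff_eq_zero_or_eq_one.1 (x.2.1 n)

variable {E : Type*} [NormedAddCommGroup E] [NormedSpace ℝ E]

/-- The function `x ↦ (-1) ^ x n • u`. -/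
noncomputable def signedConst (u : E) (n : ℕ) : BoundedContinuousFunction ZOSeq E :=
  BoundedContinuousFunction.ofNormedAddCommGroupDiscrete
    (fun x => (-1 : ℝ) ^ x.1 n • u) ‖u‖ fun x => by simp [norm_smul]

@[simp]
theorem signedConst_apply (u : E) (n : ℕ) (x : ZOSeq) :
    signedConst u n x = (-1 : ℝ) ^ x.1 n • u := rfl

theorem norm_sub_signedConst (u : E) (n : ℕ) (x : ZOSeq) :
    ‖u - signedConst u n x‖ = 2 * ‖u‖ * x.1 n := by
  rcases x.val_eq_zero_or_one n with h | h
  · simp [h]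
  · simp [h, ← two_smul ℝ u, norm_smul]

theorem two_mul_norm_le_dist_signedConst (u : E) {m n : ℕ} (h : m ≠ n) :
    2 * ‖u‖ ≤ dist (signedConst u m) (signedConst u n) := by
  refine le_trans (le_of_eq ?_) (BoundedContinuousFunction.dist_coe_le_dist (single n))
  have := norm_sub_signedConst u n (single n)
  rw [single_val_self] at this
  simpa [dist_eq_norm, single_val_self, single_val_of_ne h] using this.symm

/-- If a set of functions contains a unit constant together with all its signed variants, then
its difference set violates condition (B). -/
theorem not_condB_sub {S : Set (BoundedContinuousFunction ZOSeq E)} {u : E} (hu : ‖u‖ = 1)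
    (hconst : BoundedContinuousFunction.const ZOSeq u ∈ S) (hsigned : ∀ n, signedConst u n ∈ S) :
    ¬ CondB (S - S) := by
  intro hB
  obtain ⟨N, U, hU, hUB⟩ := hB 1 one_pos
  have hmem : ∀ x, ∃ i, x ∈ U i := fun x => Set.mem_iUnion.1 (hU ▸ Set.mem_univ x)
  choose c hc using hmem
  obtain ⟨x, y, hxy, hcxy⟩ := Finite.exists_ne_map_eq_of_infinite c
  obtain ⟨n, hn⟩ : ∃ n, x.1 n ≠ y.1 n := by
    by_contra! h
    exact hxy (Subtype.ext (funext h))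
  have h := hUB (c x) x (hc x) y (hcxy ▸ hc y) _ (Set.sub_mem_sub hconst (hsigned n))
  simp only [BoundedContinuousFunction.sub_apply, BoundedContinuousFunction.const_apply,
    norm_sub_signedConst, hu] at h
  rcases x.val_eq_zero_or_one n with hx | hx <;> rcases y.val_eq_zero_or_one n with hy | hy
  · exact hn (hx.trans hy.symm)
  · norm_num [hx, hy] at h
  · norm_num [hx, hy] at h
  · exact hn (hx.trans hy.symm)

end ZOSeq

/-- Let `X` be the set of zero-one sequences with finitely many non-zero terms and let
`E` be an infinite-dimensional normed space.  Then there is a non-empty `A ⊆ B(X,E)`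
such that: (a) `A` satisfies condition (B); (b) `A - A` does not satisfy condition (B);
(c) every section `A(x)` is compact; (d) `A(X)` is not precompact; (e) `A` is not
precompact in `B(X,E)`. -/
theorem stmt_3 {E : Type*} [NormedAddCommGroup E] [NormedSpace ℝ E]
    (hE : ¬ FiniteDimensional ℝ E) :
    ∃ A : Set (BoundedContinuousFunction ZOSeq E),
      A.Nonempty ∧
      CondB A ∧
      ¬ CondB (A - A) ∧
      (∀ x : ZOSeq, IsCompact ((fun f : BoundedContinuousFunction ZOSeq E => f x) '' A)) ∧
      ¬ TotallyBounded
          (⋃ x : ZOSeq, (fun f : BoundedContinuousFunction ZOSeq E => f x) '' A) ∧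
      ¬ TotallyBounded A := by
  have : Nontrivial E := by
    by_contra h
    rw [not_nontrivial_iff_subsingleton] at h
    exact hE inferInstance
  obtain ⟨u, hu⟩ := exists_norm_eq E zero_le_one
  obtain ⟨R, v, -, hvR, hv⟩ := exists_seq_norm_le_one_le_norm_sub (𝕜 := ℝ) hE
  let h : BoundedContinuousFunction ZOSeq E :=
    BoundedContinuousFunction.ofNormedAddCommGroupDiscrete
      (fun x => v (Function.invFun ZOSeq.single x)) R fun x => hvR _
  have h_single (n : ℕ) : h (ZOSeq.single n) = v n :=
    congrArg v (Function.leftInverse_invFun ZOSeq.single_injective n)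
  let A : Set (BoundedContinuousFunction ZOSeq E) :=
    {BoundedContinuousFunction.const ZOSeq u, h} ∪ Set.range (ZOSeq.signedConst u)
  have hconst : BoundedContinuousFunction.const ZOSeq u ∈ A := .inl (.inl rfl)
  have hh : h ∈ A := .inl (.inr rfl)
  have hsigned (n : ℕ) : ZOSeq.signedConst u n ∈ A := .inr ⟨n, rfl⟩
  refine ⟨A, ⟨h, hh⟩, condB_of_forall_norm_eq_or_eq h ?_, ZOSeq.not_condB_sub hu hconst hsigned,
    fun x => ?_, fun htb => ?_, fun htb => ?_⟩
  · rintro f ((rfl | rfl) | ⟨n, rfl⟩)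
    · exact .inl fun x y => rfl
    · exact .inr rfl
    · exact .inl fun x y => by simp [norm_smul]
  · refine ((Set.toFinite {u, -u, h x}).subset ?_).isCompact
    rintro _ ⟨f, (rfl | rfl) | ⟨n, rfl⟩, rfl⟩
    · simp
    · simp
    · rcases x.val_eq_zero_or_one n with hx | hx <;> simp [hx]
  · refine htb.not_forall_one_le_dist (v := v)
      (fun n => Set.mem_iUnion.2 ⟨ZOSeq.single n, h, hh, h_single n⟩) fun m n hmn => ?_
    rw [dist_eq_norm]
    exact hv hmn
  · refine htb.not_forall_one_le_dist hsigned fun m n hmn => ?_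
    linarith [ZOSeq.two_mul_norm_le_dist_signedConst u hmn]
end

section
/- Let n ∈ ℕ, let 𝕂 be ℝ or ℂ, and let X be a non-empty set. A non-empty set A ⊆ B(X, 𝕂^n) is relatively compact in B(X, 𝕂^n) if and only if it is bounded and satisfies the condition (DS). -/
open Pointwise

/-- Condition (DS). -/
def CondDS {X E : Type*} [TopologicalSpace X] [NormedAddCommGroup E]
    (S : Set (BoundedContinuousFunction X E)) : Prop :=
  ∀ ε : ℝ, 0 < ε → ∃ (N : ℕ) (U : Fin N → Set X),
    (∀ i, (U i).Nonempty) ∧ (⋃ i, U i) = Set.univ ∧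
    ∀ i : Fin N, ∀ x ∈ U i, ∀ y ∈ U i, ∀ f ∈ S, ‖f x - f y‖ ≤ ε

/-- A map with bounded range in a proper space has a finite `ε`-net of points of its domain. -/
theorem exists_finite_net_of_isBounded_range {Y Z : Type*} [PseudoMetricSpace Z] [ProperSpace Z]
    {φ : Y → Z} (hφ : Bornology.IsBounded (Set.range φ)) {ε : ℝ} (hε : 0 < ε) :
    ∃ t : Set Y, t.Finite ∧ ∀ x, ∃ y ∈ t, dist (φ x) (φ y) < ε := by
  have h := Metric.finite_approx_of_totallyBounded
    (hφ.isCompact_closure.totallyBounded.subset subset_closure) ε hε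
  rw [← Set.image_univ, Set.exists_subset_image_finite_and] at h
  obtain ⟨t, -, ht, hcov⟩ := h
  refine ⟨t, ht, fun x => ?_⟩
  simpa using hcov (Set.mem_image_of_mem φ (Set.mem_univ x))

theorem TotallyBounded.condDS {X E : Type*} [TopologicalSpace X] [NormedAddCommGroup E]
    [ProperSpace E] {A : Set (BoundedContinuousFunction X E)} (hA : TotallyBounded A) :
    CondDS A := by
  intro ε hε
  obtain ⟨s, hs, hAs⟩ := Metric.totallyBounded_iff.1 hA (ε / 4) (by positivity)
  have := hs.fintype
  let φ : X → s → E := fun x g => g.1 x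
  have hφ : Bornology.IsBounded (Set.range φ) := by
    rw [← Bornology.forall_isBounded_image_eval_iff]
    intro g
    refine g.1.isBounded_range.subset ?_
    rintro _ ⟨_, ⟨x, rfl⟩, rfl⟩
    exact ⟨x, rfl⟩
  obtain ⟨t, ht, hnet⟩ := exists_finite_net_of_isBounded_range hφ (ε := ε / 4) (by positivity)
  obtain ⟨N, e, -, rfl⟩ := ht.fin_param
  refine ⟨N, fun i => {x | dist (φ x) (φ (e i)) < ε / 4}, fun i => ⟨e i, ?_⟩, ?_, ?_⟩
  · simpa using hε
  · refine Set.eq_univ_of_forall fun x => Set.mem_iUnion.2 ?_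
    obtain ⟨_, ⟨i, rfl⟩, hi⟩ := hnet x
    exact ⟨i, hi⟩
  · intro i x hx y hy f hf
    obtain ⟨g, hg, hfg⟩ := Set.mem_iUnion₂.1 (hAs hf)
    have hfg : dist f g < ε / 4 := hfg
    have hfx := BoundedContinuousFunction.dist_coe_le_dist (f := f) (g := g) x
    have hfy := BoundedContinuousFunction.dist_coe_le_dist (f := f) (g := g) y
    have hgx : dist (g x) (g (e i)) ≤ dist (φ x) (φ (e i)) :=
      dist_le_pi_dist (φ x) (φ (e i)) ⟨g, hg⟩
    have hgy : dist (g y) (g (e i)) ≤ dist (φ y) (φ (e i)) :=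
      dist_le_pi_dist (φ y) (φ (e i)) ⟨g, hg⟩
    have hx : dist (φ x) (φ (e i)) < ε / 4 := hx
    have hy : dist (φ y) (φ (e i)) < ε / 4 := hy
    have h₁ := dist_triangle4 (f x) (g x) (g y) (f y)
    have h₂ := dist_triangle_right (g x) (g y) (g (e i))
    rw [dist_comm (g y) (f y)] at h₁
    rw [← dist_eq_norm]
    linarith

theorem CondDS.totallyBounded {X E : Type*} [TopologicalSpace X] [NormedAddCommGroup E]
    [ProperSpace E] {A : Set (BoundedContinuousFunction X E)} (hA : CondDS A)
    (hb : Bornology.IsBounded A) : TotallyBounded A := by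
  rw [Metric.totallyBounded_iff]
  intro ε hε
  obtain ⟨N, U, hne, hU, hosc⟩ := hA (ε / 4) (by positivity)
  choose p hp using hne
  let φ : A → Fin N → E := fun f i => f.1 (p i)
  have hφ : Bornology.IsBounded (Set.range φ) := by
    rw [← Bornology.forall_isBounded_image_eval_iff]
    intro i
    obtain ⟨C, hC⟩ := hb.exists_norm_le
    refine isBounded_iff_forall_norm_le.2 ⟨C, ?_⟩
    rintro _ ⟨_, ⟨f, rfl⟩, rfl⟩
    exact (f.1.norm_coe_le_norm (p i)).trans (hC f f.2)
  obtain ⟨t, ht, hnet⟩ := exists_finite_net_of_isBounded_range hφ (ε := ε / 4) (by positivity)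
  refine ⟨Subtype.val '' t, ht.image _, fun f hf => ?_⟩
  obtain ⟨g, hg, hfg⟩ := hnet ⟨f, hf⟩
  refine Set.mem_iUnion₂.2 ⟨g, Set.mem_image_of_mem _ hg, Metric.mem_ball.2 ?_⟩
  suffices dist f g.1 ≤ 3 * (ε / 4) by linarith
  refine (BoundedContinuousFunction.dist_le (by positivity)).2 fun x => ?_
  obtain ⟨i, hi⟩ := Set.mem_iUnion.1 (hU ▸ Set.mem_univ x)
  have h₁ := hosc i x hi (p i) (hp i) f hf
  have h₂ := hosc i (p i) (hp i) x hi g g.2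
  have h₃ : dist (f (p i)) (g.1 (p i)) ≤ dist (φ ⟨f, hf⟩) (φ g) :=
    dist_le_pi_dist (φ ⟨f, hf⟩) (φ g) i
  rw [← dist_eq_norm] at h₁ h₂
  linarith [dist_triangle4 (f x) (f (p i)) (g.1 (p i)) (g.1 x)]

/-- **Dunford–Schwartz type criterion.**  Let `𝕂` be `ℝ` or `ℂ` and `X` a non-empty set
(a discrete space, so that `X →ᵇ 𝕂ⁿ` is `B(X,𝕂ⁿ)`).  A non-empty set
`A ⊆ B(X,𝕂ⁿ)` is relatively compact iff it is bounded and satisfies (DS). -/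
theorem stmt_5 (n : ℕ) (𝕂 : Type*) [RCLike 𝕂] {X : Type*} [Nonempty X]
    [TopologicalSpace X] [DiscreteTopology X]
    (A : Set (BoundedContinuousFunction X (EuclideanSpace 𝕂 (Fin n)))) (hA : A.Nonempty) :
    IsCompact (closure A) ↔ Bornology.IsBounded A ∧ CondDS A := by
  constructor
  · intro h
    have ht : TotallyBounded A := h.totallyBounded.subset subset_closure
    exact ⟨ht.isBounded, ht.condDS⟩
  · rintro ⟨hb, hds⟩
    exact (hds.totallyBounded hb).closure.isCompact_of_isClosed isClosed_closure
end

section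
/- Let X be a compact Hausdorff topological space and (E, ‖·‖_E) an arbitrary normed space. A non-empty subset A of C(X,E) is precompact if and only if A satisfies the condition (DS) and for every x ∈ X the section A(x) is precompact in E. -/
open Pointwise

/-- A product of totally bounded sets is totally bounded. -/
theorem totallyBounded_univ_pi {ι : Type*} {α : ι → Type*} [∀ i, UniformSpace (α i)]
    {s : ∀ i, Set (α i)} (hs : ∀ i, TotallyBounded (s i)) :
    TotallyBounded (Set.univ.pi s) := by
  refine totallyBounded_iff_ultrafilter.2 fun f hf => ?_
  refine (cauchy_pi_iff' α).2 fun i => ?_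
  refine totallyBounded_iff_ultrafilter.1 (hs i) (f.map (Function.eval i)) ?_
  have h : ∀ᶠ x in (f : Filter _), x ∈ Set.univ.pi s := Filter.le_principal_iff.1 hf
  exact Filter.le_principal_iff.2 (h.mono fun x hx => hx i (Set.mem_univ i))

/-- Let `X` be a compact Hausdorff space and `E` an arbitrary normed space.  A non-empty
subset `A` of `C(X,E)` is precompact iff `A` satisfies (DS) and every section `A(x)` is
precompact in `E`. -/
theorem stmt_9 {X E : Type*} [TopologicalSpace X] [CompactSpace X] [T2Space X]
    [NormedAddCommGroup E] [NormedSpace ℝ E]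
    (A : Set (BoundedContinuousFunction X E)) (hA : A.Nonempty) :
    TotallyBounded A ↔
      CondDS A ∧
        ∀ x : X, TotallyBounded ((fun f : BoundedContinuousFunction X E => f x) '' A) := by
  constructor
  · intro h
    refine ⟨fun ε hε => ?_, fun x => ?_⟩
    · obtain ⟨t, htf, ht⟩ := Metric.totallyBounded_iff.1 h (ε / 4) (by positivity)
      let V : X → Set X := fun x => {y | ∀ g ∈ t, ‖g y - g x‖ < ε / 4}
      have hV : ∀ x, V x ∈ nhds x := fun x => by
        refine (Filter.eventually_all_finite htf).2 fun g _ => ?_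
        have hg := Metric.tendsto_nhds.1 (g.continuous.tendsto x) (ε / 4) (by positivity)
        simpa only [dist_eq_norm] using hg
      obtain ⟨s, hs⟩ := CompactSpace.elim_nhds_subcover V hV
      refine ⟨s.card, fun i => V (s.equivFin.symm i), fun i => ⟨_, mem_of_mem_nhds (hV _)⟩,
        ?_, ?_⟩
      · refine Set.eq_univ_of_forall fun y => ?_
        have hy : y ∈ ⋃ x ∈ s, V x := hs ▸ Set.mem_univ y
        obtain ⟨x, hx, hyx⟩ := Set.mem_iUnion₂.1 hy
        exact Set.mem_iUnion.2 ⟨s.equivFin ⟨x, hx⟩, by simpa using hyx⟩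
      · intro i x hx y hy f hf
        obtain ⟨g, hg, hfg⟩ := Set.mem_iUnion₂.1 (ht hf)
        have h1 := (BoundedContinuousFunction.dist_coe_le_dist (f := f) (g := g) x).trans_lt hfg
        have h2 := (BoundedContinuousFunction.dist_coe_le_dist (f := f) (g := g) y).trans_lt hfg
        have h3 := hx g hg
        have h4 := hy g hg
        rw [← dist_eq_norm] at h3 h4 ⊢
        set z : X := (s.equivFin.symm i : X)
        have h5 := dist_triangle4 (f x) (g x) (g y) (f y)
        have h6 := dist_triangle_right (g x) (g y) (g z)
        rw [dist_comm (g y) (f y)] at h5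
        linarith
    · exact h.image (BoundedContinuousFunction.lipschitz_eval_const x).uniformContinuous
  · rintro ⟨hDS, hsec⟩
    refine Metric.totallyBounded_iff.2 fun ε hε => ?_
    obtain ⟨N, U, hne, hU, hosc⟩ := hDS (ε / 4) (by positivity)
    choose p hp using hne
    let Φ : BoundedContinuousFunction X E → Fin N → E := fun f i => f (p i)
    have hΦ : TotallyBounded (Φ '' A) :=
      (totallyBounded_univ_pi fun i => hsec (p i)).subset (by
        rintro _ ⟨f, hf, rfl⟩ i _
        exact ⟨f, hf, rfl⟩)
    obtain ⟨s, hsA, hsf, ht⟩ := Set.exists_subset_image_finite_and.1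
      (Metric.finite_approx_of_totallyBounded hΦ (ε / 4) (by positivity))
    refine ⟨s, hsf, fun f hf => ?_⟩
    obtain ⟨_, ⟨g, hg, rfl⟩, hfg⟩ := Set.mem_iUnion₂.1 (ht ⟨f, hf, rfl⟩)
    refine Set.mem_iUnion₂.2 ⟨g, hg, Metric.mem_ball.2 ?_⟩
    refine lt_of_le_of_lt ((BoundedContinuousFunction.dist_le
      (C := 3 * (ε / 4)) (by positivity)).2 fun x => ?_) (by linarith)
    obtain ⟨i, hi⟩ := Set.mem_iUnion.1 (hU ▸ Set.mem_univ x : x ∈ ⋃ i, U i)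
    have h1 := hosc i x hi (p i) (hp i) f hf
    have h2 := hosc i (p i) (hp i) x hi g (hsA hg)
    have h3 : dist (f (p i)) (g (p i)) < ε / 4 := (dist_le_pi_dist (Φ f) (Φ g) i).trans_lt hfg
    rw [← dist_eq_norm] at h1 h2
    linarith [dist_triangle4 (f x) (f (p i)) (g (p i)) (g x)]
end

section
/- Let φ be a comparison function, (X, d) a metric space with a fixed base point x_*, and (E, ‖·‖_E) a normed space. A non-empty subset A of Lip_φ(X,E) is precompact (with respect to the norm ‖f‖_φ = ‖f(x_*)‖_E + |f|_φ) if and only if the set A − A satisfies the condition (L) and the sections A(x) := {f(x) : f ∈ A} are precompact in E for every x ∈ X. -/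
open Pointwise Metric

/-- A comparison function: a non-zero function `φ : [0,∞) → [0,∞)` which is
right-continuous at `0`, concave and vanishes at `0`. -/
structure IsCompFun (φ : ℝ → ℝ) : Prop where
  nonneg : ∀ t : ℝ, 0 ≤ t → 0 ≤ φ t
  map_zero : φ 0 = 0
  right_cont : ContinuousWithinAt φ (Set.Ici 0) 0
  concave : ConcaveOn ℝ (Set.Ici 0) φ
  ne_zero : ∃ t : ℝ, 0 ≤ t ∧ φ t ≠ 0

/-- The Lipschitz seminorm `|f|_φ = sup_{x ≠ y} ‖f x - f y‖ / φ(d(x,y))`. -/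
noncomputable def lipSemi {X E : Type*} [MetricSpace X] [NormedAddCommGroup E]
    (φ : ℝ → ℝ) (f : X → E) : ℝ :=
  sSup {r : ℝ | ∃ x y : X, x ≠ y ∧ r = ‖f x - f y‖ / φ (dist x y)}

/-- Membership in `Lip_φ(X,E)`: the quotients `‖f x - f y‖ / φ(d(x,y))` are bounded
above, i.e. `|f|_φ < ∞`. -/
def MemLip {X E : Type*} [MetricSpace X] [NormedAddCommGroup E]
    (φ : ℝ → ℝ) (f : X → E) : Prop :=
  BddAbove {r : ℝ | ∃ x y : X, x ≠ y ∧ r = ‖f x - f y‖ / φ (dist x y)}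

/-- The norm `‖f‖_φ = ‖f x₀‖ + |f|_φ` of `Lip_φ(X,E)` (with base point `x₀`). -/
noncomputable def lipNorm {X E : Type*} [MetricSpace X] [NormedAddCommGroup E]
    (φ : ℝ → ℝ) (x₀ : X) (f : X → E) : ℝ :=
  ‖f x₀‖ + lipSemi φ f

/-- Precompactness (total boundedness) of `A` with respect to the gauge `N`:
for every `ε > 0` there is a finite `ε`-net for `A` contained in `A`. -/
def Precomp {α : Type*} [Sub α] (N : α → ℝ) (A : Set α) : Prop :=
  ∀ ε : ℝ, 0 < ε → ∃ T : Set α, T ⊆ A ∧ T.Finite ∧ ∀ f ∈ A, ∃ g ∈ T, N (f - g) ≤ ε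

/-- Condition (L): for every `ε > 0` there is a finite cover `U_1, …, U_N` of
`X̃ = (X×X) \ Δ` such that the quotients `‖f x - f y‖/φ(d(x,y))` vary by at most `ε`
on each `U_i`, uniformly in `f ∈ S`. -/
def CondL {X E : Type*} [MetricSpace X] [NormedAddCommGroup E]
    (φ : ℝ → ℝ) (S : Set (X → E)) : Prop :=
  ∀ ε : ℝ, 0 < ε → ∃ (N : ℕ) (U : Fin N → Set (X × X)),
    (∀ i, U i ⊆ {p : X × X | p.1 ≠ p.2}) ∧
    {p : X × X | p.1 ≠ p.2} ⊆ ⋃ i, U i ∧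
    ∀ i : Fin N, ∀ p ∈ U i, ∀ q ∈ U i, ∀ f ∈ S,
      |‖f p.1 - f p.2‖ / φ (dist p.1 p.2) - ‖f q.1 - f q.2‖ / φ (dist q.1 q.2)| ≤ ε

theorem IsCompFun.pos {φ : ℝ → ℝ} (hφ : IsCompFun φ) {t : ℝ} (ht : 0 < t) : 0 < φ t := by
  obtain ⟨s, hs, hne⟩ := hφ.ne_zero
  have hφs : 0 < φ s := lt_of_le_of_ne (hφ.nonneg s hs) (Ne.symm hne)
  have hs0 : 0 < s := lt_of_le_of_ne hs (by rintro rfl; exact hne hφ.map_zero)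
  rcases le_total t s with h | h
  · have hts : t / s ≤ 1 := (div_le_one hs0).2 h
    have key := hφ.concave.2 (Set.mem_Ici.2 hs) (Set.mem_Ici.2 le_rfl)
      (div_pos ht hs0).le (sub_nonneg.2 hts) (by ring)
    simp only [smul_eq_mul, hφ.map_zero, mul_zero, add_zero, div_mul_cancel₀ t hs0.ne'] at key
    exact (mul_pos (div_pos ht hs0) hφs).trans_le key
  · have hu : 0 ≤ 2 * t - s := by linarith
    have key := hφ.concave.2 (Set.mem_Ici.2 hs) (Set.mem_Ici.2 hu)
      (by norm_num : (0 : ℝ) ≤ 1 / 2) (by norm_num : (0 : ℝ) ≤ 1 / 2) (by norm_num)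
    simp only [smul_eq_mul] at key
    have heq : 1 / 2 * s + 1 / 2 * (2 * t - s) = t := by ring
    rw [heq] at key
    have := hφ.nonneg _ hu
    linarith

/-- A subset of a product is totally bounded as soon as all its projections are. -/
theorem totallyBounded_of_forall_image_eval {ι : Type*} {α : ι → Type*}
    [∀ i, UniformSpace (α i)] {s : Set (∀ i, α i)}
    (h : ∀ i, TotallyBounded ((fun f : ∀ i, α i => f i) '' s)) : TotallyBounded s := by
  rw [totallyBounded_iff_ultrafilter]
  intro F hF
  rw [cauchy_pi_iff']
  intro i
  refine totallyBounded_iff_ultrafilter.1 (h i) (F.map fun f => f i) ?_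
  rw [Ultrafilter.coe_map, Filter.le_principal_iff]
  exact Filter.image_mem_map (Filter.le_principal_iff.1 hF)

section

variable {X E : Type*} [MetricSpace X] [NormedAddCommGroup E] {φ : ℝ → ℝ} {f g : X → E}

theorem MemLip.div_le (hf : MemLip φ f) {x y : X} (h : x ≠ y) :
    ‖f x - f y‖ / φ (dist x y) ≤ lipSemi φ f :=
  le_csSup hf ⟨x, y, h, rfl⟩

theorem lipSemi_nonneg (hφ : IsCompFun φ) (f : X → E) : 0 ≤ lipSemi φ f := by
  refine Real.sSup_nonneg ?_
  rintro r ⟨x, y, -, rfl⟩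
  exact div_nonneg (norm_nonneg _) (hφ.nonneg _ dist_nonneg)

theorem lipSemi_le_lipNorm (x₀ : X) (f : X → E) : lipSemi φ f ≤ lipNorm φ x₀ f :=
  le_add_of_nonneg_left (norm_nonneg _)

theorem MemLip.sub_div_le (hφ : IsCompFun φ) (hf : MemLip φ f) (hg : MemLip φ g) {x y : X}
    (h : x ≠ y) :
    ‖(f - g) x - (f - g) y‖ / φ (dist x y) ≤ lipSemi φ f + lipSemi φ g := by
  refine le_trans ?_ (add_le_add (hf.div_le h) (hg.div_le h))
  rw [← add_div]
  refine div_le_div_of_nonneg_right ?_ (hφ.nonneg _ dist_nonneg)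
  rw [Pi.sub_apply, Pi.sub_apply, sub_sub_sub_comm]
  exact norm_sub_le _ _

theorem MemLip.sub (hφ : IsCompFun φ) (hf : MemLip φ f) (hg : MemLip φ g) :
    MemLip φ (f - g) := by
  refine ⟨lipSemi φ f + lipSemi φ g, ?_⟩
  rintro r ⟨x, y, h, rfl⟩
  exact hf.sub_div_le hφ hg h

theorem MemLip.norm_sub_le_mul (hφ : IsCompFun φ) (hf : MemLip φ f) (x y : X) :
    ‖f x - f y‖ ≤ lipSemi φ f * φ (dist x y) := by
  rcases eq_or_ne x y with rfl | h
  · simp [hφ.map_zero]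
  · exact (div_le_iff₀ (hφ.pos (dist_pos.2 h))).1 (hf.div_le h)

theorem MemLip.norm_apply_le (hφ : IsCompFun φ) (hf : MemLip φ f) (x₀ x : X) :
    ‖f x‖ ≤ lipNorm φ x₀ f * (1 + φ (dist x x₀)) := by
  have h1 := hf.norm_sub_le_mul hφ x x₀
  have h2 : ‖f x‖ ≤ ‖f x₀‖ + ‖f x - f x₀‖ := norm_le_norm_add_norm_sub' _ _
  have h3 := hφ.nonneg (dist x x₀) dist_nonneg
  have h4 := lipSemi_nonneg hφ f
  have h5 := mul_nonneg (norm_nonneg (f x₀)) h3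
  unfold lipNorm
  nlinarith

theorem MemLip.abs_div_sub_div_le (hφ : IsCompFun φ) (hfg : MemLip φ (f - g)) {x y : X}
    (h : x ≠ y) :
    |‖f x - f y‖ / φ (dist x y) - ‖g x - g y‖ / φ (dist x y)| ≤ lipSemi φ (f - g) := by
  refine le_trans ?_ (hfg.div_le h)
  have hpos := hφ.pos (dist_pos.2 h)
  rw [← sub_div, abs_div, abs_of_pos hpos]
  refine div_le_div_of_nonneg_right ?_ hpos.le
  rw [Pi.sub_apply, Pi.sub_apply, sub_sub_sub_comm]
  exact abs_norm_sub_norm_le _ _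

theorem lipSemi_sub_le (hφ : IsCompFun φ) (hf : MemLip φ f) (hg : MemLip φ g) :
    lipSemi φ (f - g) ≤ lipSemi φ f + lipSemi φ g := by
  refine Real.sSup_le ?_ (add_nonneg (lipSemi_nonneg hφ f) (lipSemi_nonneg hφ g))
  rintro r ⟨x, y, h, rfl⟩
  exact hf.sub_div_le hφ hg h

theorem Precomp.totallyBounded_image_eval (hφ : IsCompFun φ) {x₀ : X} {A : Set (X → E)}
    (hAL : ∀ f ∈ A, MemLip φ f) (hA : Precomp (lipNorm φ x₀) A) (x : X) :
    TotallyBounded ((fun f : X → E => f x) '' A) := by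
  rw [Metric.totallyBounded_iff]
  intro ε hε
  have hc : 0 < 1 + φ (dist x x₀) := by
    have := hφ.nonneg (dist x x₀) dist_nonneg
    linarith
  obtain ⟨T, hTA, hT, hnet⟩ := hA (ε / 2 / (1 + φ (dist x x₀))) (by positivity)
  refine ⟨(fun f : X → E => f x) '' T, hT.image _, ?_⟩
  rintro _ ⟨f, hf, rfl⟩
  obtain ⟨g, hg, hfg⟩ := hnet f hf
  refine Set.mem_biUnion (Set.mem_image_of_mem _ hg) ?_
  rw [Metric.mem_ball, dist_eq_norm]
  have h1 := ((hAL f hf).sub hφ (hAL g (hTA hg))).norm_apply_le hφ x₀ x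
  have h2 := (le_div_iff₀ hc).1 hfg
  rw [Pi.sub_apply] at h1
  linarith

/-- A finite set of `φ`-Lipschitz maps satisfies condition (L). -/
theorem condL_of_finite (hφ : IsCompFun φ) {S : Set (X → E)} (hS : S.Finite)
    (hSL : ∀ f ∈ S, MemLip φ f) : CondL φ S := by
  intro ε hε
  have := hS.fintype
  let q : X × X → S → ℝ := fun p f => ‖f.1 p.1 - f.1 p.2‖ / φ (dist p.1 p.2)
  have hq : TotallyBounded (q '' {p | p.1 ≠ p.2}) := by
    refine totallyBounded_of_forall_image_eval fun f => ?_
    refine (isCompact_Icc (a := 0) (b := lipSemi φ f.1)).totallyBounded.subset ?_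
    rintro _ ⟨_, ⟨p, hp, rfl⟩, rfl⟩
    exact ⟨div_nonneg (norm_nonneg _) (hφ.nonneg _ dist_nonneg), (hSL f.1 f.2).div_le hp⟩
  obtain ⟨t, ht, hcov⟩ := Metric.totallyBounded_iff.1 hq (ε / 2) (by linarith)
  have := ht.to_subtype
  obtain ⟨N, ⟨e⟩⟩ := Finite.exists_equiv_fin t
  refine ⟨N, fun i => {p | p.1 ≠ p.2 ∧ q p ∈ Metric.ball (e.symm i).1 (ε / 2)},
    fun i p hp => hp.1, fun p hp => ?_, ?_⟩
  · obtain ⟨y, hy, hpy⟩ := Set.mem_iUnion₂.1 (hcov (Set.mem_image_of_mem q hp))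
    exact Set.mem_iUnion.2 ⟨e ⟨y, hy⟩, hp, by simpa using hpy⟩
  · intro i p hp p' hp' f hf
    have h1 : dist (q p) (q p') < ε := by
      have := dist_triangle_right (q p) (q p') (e.symm i).1
      have h2 := Metric.mem_ball.1 hp.2
      have h3 := Metric.mem_ball.1 hp'.2
      linarith
    exact (dist_le_pi_dist (q p) (q p') ⟨f, hf⟩).trans h1.le

theorem Precomp.condL_sub (hφ : IsCompFun φ) {x₀ : X} {A : Set (X → E)}
    (hAL : ∀ f ∈ A, MemLip φ f) (hA : Precomp (lipNorm φ x₀) A) : CondL φ (A - A) := by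
  intro ε hε
  obtain ⟨T, hTA, hT, hnet⟩ := hA (ε / 5) (by linarith)
  have hTL : ∀ k ∈ T - T, MemLip φ k := by
    rintro _ ⟨g, hg, g', hg', rfl⟩
    exact (hAL g (hTA hg)).sub hφ (hAL g' (hTA hg'))
  obtain ⟨N, U, hU, hcov, hosc⟩ := condL_of_finite hφ (hT.sub hT) hTL (ε / 5) (by linarith)
  refine ⟨N, U, hU, hcov, ?_⟩
  rintro i p hp p' hp' _ ⟨f, hf, f', hf', rfl⟩
  obtain ⟨g, hg, hfg⟩ := hnet f hf
  obtain ⟨g', hg', hfg'⟩ := hnet f' hf'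
  have hL := (hAL f hf).sub hφ (hAL g (hTA hg))
  have hL' := (hAL f' hf').sub hφ (hAL g' (hTA hg'))
  have heq : (f - f') - (g - g') = (f - g) - (f' - g') := sub_sub_sub_comm _ _ _ _
  have hM : MemLip φ ((f - f') - (g - g')) := heq ▸ hL.sub hφ hL'
  have hle : lipSemi φ ((f - f') - (g - g')) ≤ 2 * (ε / 5) := by
    rw [heq]
    have h1 := lipSemi_sub_le hφ hL hL'
    have h2 := lipSemi_le_lipNorm (φ := φ) x₀ (f - g)
    have h3 := lipSemi_le_lipNorm (φ := φ) x₀ (f' - g')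
    linarith
  have h1 := abs_le.1 ((hM.abs_div_sub_div_le hφ (hU i hp)).trans hle)
  have h2 := abs_le.1 ((hM.abs_div_sub_div_le hφ (hU i hp')).trans hle)
  have h3 := abs_le.1 (hosc i p hp p' hp' (g - g') (Set.sub_mem_sub hg hg'))
  exact abs_le.2 ⟨by linarith, by linarith⟩

theorem CondL.precomp [NormedSpace ℝ E] (hφ : IsCompFun φ) (x₀ : X) {A : Set (X → E)}
    (hL : CondL φ (A - A)) (hA : ∀ x : X, TotallyBounded ((fun f : X → E => f x) '' A)) :
    Precomp (lipNorm φ x₀) A := by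
  intro ε hε
  obtain ⟨N, U, -, hcov, hosc⟩ := hL (ε / 3) (by linarith)
  have hex : ∀ i, ∃ p : X × X, (U i).Nonempty → p ∈ U i := fun i => by
    by_cases h : (U i).Nonempty
    · exact ⟨h.some, fun _ => h.some_mem⟩
    · exact ⟨(x₀, x₀), fun h' => absurd h' h⟩
  choose p hp using hex
  let G : (X → E) → E × (Fin N → E) := fun f =>
    (f x₀, fun i => (φ (dist (p i).1 (p i).2))⁻¹ • (f (p i).1 - f (p i).2))
  have hG : UniformContinuous G := by
    have hev (x : X) : UniformContinuous fun f : X → E => f x := Pi.uniformContinuous_proj _ x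
    exact (hev x₀).prodMk (uniformContinuous_pi.2 fun i => ((hev _).sub (hev _)).const_smul _)
  have hTB := (totallyBounded_of_forall_image_eval hA).image hG
  obtain ⟨t, htA, ht, hnet⟩ := Metric.finite_approx_of_totallyBounded hTB (ε / 3) (by linarith)
  obtain ⟨T, hTA, hT, rfl⟩ := ht.exists_subset_finite_image_eq htA
  refine ⟨T, hTA, hT, fun f hf => ?_⟩
  obtain ⟨_, ⟨g, hg, rfl⟩, hfg⟩ := Set.mem_iUnion₂.1 (hnet (Set.mem_image_of_mem G hf))
  refine ⟨g, hg, ?_⟩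
  rw [Metric.mem_ball, Prod.dist_eq, max_lt_iff] at hfg
  have h0 : ‖(f - g) x₀‖ < ε / 3 := by simpa [G, dist_eq_norm] using hfg.1
  have hs : lipSemi φ (f - g) ≤ 2 * (ε / 3) := by
    refine Real.sSup_le ?_ (by linarith)
    rintro r ⟨x, y, hxy, rfl⟩
    obtain ⟨i, hi⟩ := Set.mem_iUnion.1 (hcov (show (x, y) ∈ {p : X × X | p.1 ≠ p.2} from hxy))
    have h1 := abs_le.1 (hosc i (x, y) hi (p i) (hp i ⟨_, hi⟩) (f - g)
      (Set.sub_mem_sub hf (hTA hg)))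
    have h2 := ((dist_le_pi_dist (G f).2 (G g).2 i).trans_lt hfg.2).le
    simp only [G] at h2
    rw [dist_eq_norm, ← smul_sub, norm_smul, norm_inv, Real.norm_of_nonneg
      (hφ.nonneg _ dist_nonneg), sub_sub_sub_comm, inv_mul_eq_div] at h2
    simp only [Pi.sub_apply] at h1 ⊢
    linarith
  unfold lipNorm
  linarith

end

/-- **Compactness criterion in `Lip_φ(X,E)`.** -/
theorem stmt_11 {X E : Type*} [MetricSpace X] [NormedAddCommGroup E] [NormedSpace ℝ E]
    (φ : ℝ → ℝ) (hφ : IsCompFun φ) (x₀ : X)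
    (A : Set (X → E)) (hA : A.Nonempty) (hAL : ∀ f ∈ A, MemLip φ f) :
    Precomp (lipNorm φ x₀) A ↔
      CondL φ (A - A) ∧ ∀ x : X, TotallyBounded ((fun f : X → E => f x) '' A) :=
  ⟨fun h => ⟨h.condL_sub hφ hAL, h.totallyBounded_image_eval hφ hAL⟩,
    fun h => h.1.precomp hφ x₀ h.2⟩
end

section
/- Let φ be a comparison function, (X, d) a compact metric space, and (E, ‖·‖_E) a normed space. Let A be a non-empty bounded subset of Lip_φ(X,E) such that the sections A(x) := {f(x) : f ∈ A} are precompact for all x ∈ X. For a fixed δ > 0, let X̃_δ := (X×X) \ ⋃_{x∈X}(B_X(x,δ) × B_X(x,δ)), endowed with the maximum metric, and let Ã_δ consist of all restrictions to X̃_δ of the maps Φ(f) with f ∈ A, where Φ(f)(x,y) := (f(x) − f(y))/φ(d(x,y)). Then for every ε > 0 there is a finite open cover of X̃_δ such that ‖h(x,y) − h(ξ,η)‖_E ≤ ε for every h ∈ Ã_δ and all (x,y), (ξ,η) contained in the same element of the cover. -/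
open Pointwise Metric

/-- The norm `⦀f⦀_φ = ‖f‖_∞ + |f|_φ`. -/
noncomputable def bLipNorm {X E : Type*} [MetricSpace X] [NormedAddCommGroup E]
    (φ : ℝ → ℝ) (f : X → E) : ℝ :=
  (⨆ x : X, ‖f x‖) + lipSemi φ f

/-- The set `X̃_δ = (X×X) \ ⋃_{x∈X} (B(x,δ) × B(x,δ))`. -/
def XtildeDelta (X : Type*) [MetricSpace X] (δ : ℝ) : Set (X × X) :=
  {p : X × X | ∀ z : X, ¬ (dist p.1 z < δ ∧ dist p.2 z < δ)}

theorem IsCompFun.continuousOn {φ : ℝ → ℝ} (hφ : IsCompFun φ) :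
    ContinuousOn φ (Set.Ici 0) := by
  intro t ht
  rcases (Set.mem_Ici.1 ht).eq_or_lt with rfl | ht
  · exact hφ.right_cont
  · have h := hφ.concave.continuousOn_interior
    rw [interior_Ici] at h
    exact (h.continuousAt (Ioi_mem_nhds ht)).continuousWithinAt

theorem IsCompFun.continuous_comp_dist {φ : ℝ → ℝ} (hφ : IsCompFun φ) {X Y : Type*}
    [MetricSpace X] [TopologicalSpace Y] {u v : Y → X} (hu : Continuous u) (hv : Continuous v) :
    Continuous fun y => φ (dist (u y) (v y)) :=
  hφ.continuousOn.comp_continuous (hu.dist hv) fun _ => Set.mem_Ici.2 dist_nonneg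

theorem norm_sub_le_of_bLipNorm_le {X E : Type*} [MetricSpace X] [NormedAddCommGroup E]
    {φ : ℝ → ℝ} (hφ : IsCompFun φ) {f : X → E} (hf : MemLip φ f) {M : ℝ}
    (hM : bLipNorm φ f ≤ M) (x y : X) : ‖f x - f y‖ ≤ M * φ (dist x y) := by
  rcases eq_or_ne x y with rfl | hxy
  · simp [hφ.map_zero]
  · have h₁ : ‖f x - f y‖ / φ (dist x y) ≤ lipSemi φ f := le_csSup hf ⟨x, y, hxy, rfl⟩
    have h₂ : 0 ≤ ⨆ x : X, ‖f x‖ := Real.iSup_nonneg fun _ => norm_nonneg _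
    rw [← div_le_iff₀ (hφ.pos (dist_pos.2 hxy))]
    unfold bLipNorm at hM
    linarith

theorem isClosed_XtildeDelta (X : Type*) [MetricSpace X] (δ : ℝ) :
    IsClosed (XtildeDelta X δ) := by
  have h : XtildeDelta X δ = (⋃ z : X, ball z δ ×ˢ ball z δ)ᶜ := by
    ext p
    simp [XtildeDelta]
  rw [h]
  exact (isOpen_iUnion fun z => isOpen_ball.prod isOpen_ball).isClosed_compl

theorem dist_pos_of_mem_XtildeDelta {X : Type*} [MetricSpace X] {δ : ℝ} (hδ : 0 < δ)
    {p : X × X} (hp : p ∈ XtildeDelta X δ) : 0 < dist p.1 p.2 := by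
  have h := hp p.1
  rw [dist_self, dist_comm] at h
  by_contra hd
  exact h ⟨hδ, by linarith⟩

theorem norm_inv_smul_sub_inv_smul_le {E : Type*} [NormedAddCommGroup E] [NormedSpace ℝ E]
    {a b : ℝ} (hb : 0 ≤ b) (u v : E) :
    ‖b⁻¹ • v - a⁻¹ • u‖ ≤ b⁻¹ * ‖v - u‖ + |b⁻¹ - a⁻¹| * ‖u‖ := by
  calc ‖b⁻¹ • v - a⁻¹ • u‖ = ‖b⁻¹ • (v - u) + (b⁻¹ - a⁻¹) • u‖ := by
        rw [smul_sub, sub_smul, sub_add_sub_cancel]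
    _ ≤ _ := norm_add_le _ _
    _ = _ := by
        rw [norm_smul, norm_smul, Real.norm_of_nonneg (inv_nonneg.2 hb), Real.norm_eq_abs]

/-- An equicontinuous family on a compact space admits, for each `ε`,
a finite open cover on whose members every map of the family oscillates by at most `ε`. -/
theorem exists_finite_open_cover_of_equicontinuous {Y F ι : Type*} [TopologicalSpace Y]
    [CompactSpace Y] [PseudoMetricSpace F] {h : ι → Y → F} (hh : Equicontinuous h)
    {ε : ℝ} (hε : 0 < ε) :
    ∃ (N : ℕ) (U : Fin N → Set Y), (∀ i, IsOpen (U i)) ∧ (⋃ i, U i) = Set.univ ∧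
      ∀ i, ∀ p ∈ U i, ∀ q ∈ U i, ∀ j, dist (h j p) (h j q) ≤ ε := by
  have hV (p : Y) : {q | ∀ j, dist (h j p) (h j q) < ε / 2} ∈ nhds p :=
    Metric.equicontinuousAt_iff_right.1 (hh p) _ (half_pos hε)
  obtain ⟨t, ht⟩ := isCompact_univ.elim_nhds_subcover
    (fun p => interior {q | ∀ j, dist (h j p) (h j q) < ε / 2})
    fun p _ => interior_mem_nhds.2 (hV p)
  refine ⟨t.card, fun i => interior {q | ∀ j, dist (h j (t.equivFin.symm i)) (h j q) < ε / 2},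
    fun i => isOpen_interior, ?_, ?_⟩
  · refine Set.eq_univ_of_forall fun q => ?_
    obtain ⟨p, hp, hq⟩ := Set.mem_iUnion₂.1 (ht.2 (Set.mem_univ q))
    refine Set.mem_iUnion.2 ⟨t.equivFin ⟨p, hp⟩, ?_⟩
    simpa using hq
  · intro i p hp q hq j
    have h₁ := interior_subset hp j
    have h₂ := interior_subset hq j
    linarith [dist_triangle_left (h j p) (h j q) (h j (t.equivFin.symm i))]

/-- The difference quotients of a bounded subset of `Lip_φ(X,E)` are equicontinuous on
`XtildeDelta X δ`. -/
theorem equicontinuous_differenceQuotient {X E : Type*} [MetricSpace X]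
    [NormedAddCommGroup E] [NormedSpace ℝ E] {φ : ℝ → ℝ} (hφ : IsCompFun φ)
    {A : Set (X → E)} {M : ℝ} (hA : ∀ f ∈ A, ∀ x y, ‖f x - f y‖ ≤ M * φ (dist x y))
    {δ : ℝ} (hδ : 0 < δ) :
    Equicontinuous fun (f : A) (p : XtildeDelta X δ) =>
      (φ (dist (p : X × X).1 (p : X × X).2))⁻¹ •
        ((f : X → E) (p : X × X).1 - (f : X → E) (p : X × X).2) := by
  intro p
  let d : XtildeDelta X δ → ℝ := fun q => φ (dist (q : X × X).1 (q : X × X).2)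
  have hd (q : XtildeDelta X δ) : 0 < d q := hφ.pos (dist_pos_of_mem_XtildeDelta hδ q.2)
  have hfst : Continuous fun q : XtildeDelta X δ => (q : X × X).1 := by fun_prop
  have hsnd : Continuous fun q : XtildeDelta X δ => (q : X × X).2 := by fun_prop
  have hinv : Continuous fun q => (d q)⁻¹ :=
    (hφ.continuous_comp_dist hfst hsnd).inv₀ fun q => (hd q).ne'
  have h₁ := hφ.continuous_comp_dist hfst (continuous_const (y := (p : X × X).1))
  have h₂ := hφ.continuous_comp_dist hsnd (continuous_const (y := (p : X × X).2))
  let g : XtildeDelta X δ → ℝ := fun q =>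
    (d q)⁻¹ * (M * φ (dist (q : X × X).1 (p : X × X).1) +
      M * φ (dist (q : X × X).2 (p : X × X).2)) + |(d q)⁻¹ - (d p)⁻¹| * (M * d p)
  have hg : Continuous g :=
    (hinv.mul ((h₁.const_mul M).add (h₂.const_mul M))).add
      ((hinv.sub continuous_const).abs.mul continuous_const)
  have hgp : Filter.Tendsto g (nhds p) (nhds 0) := by
    have h : g p = 0 := by simp [g, hφ.map_zero]
    exact h ▸ hg.tendsto p
  refine Metric.equicontinuousAt_of_continuity_modulus g hgp _ (Filter.Eventually.of_forall ?_)
  intro q f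
  rw [dist_comm, dist_eq_norm]
  refine (norm_inv_smul_sub_inv_smul_le (hd q).le _ _).trans ?_
  refine add_le_add (mul_le_mul_of_nonneg_left ?_ (inv_nonneg.2 (hd q).le))
    (mul_le_mul_of_nonneg_left (hA f f.2 _ _) (abs_nonneg _))
  rw [sub_sub_sub_comm]
  exact (norm_sub_le _ _).trans (add_le_add (hA f f.2 _ _) (hA f f.2 _ _))

/-- **Lemma (introGH).**  Let `X` be a compact metric space, `A` a non-empty bounded
subset of `Lip_φ(X,E)` with precompact sections, and `δ > 0`.  Then for every `ε > 0`
there is a finite open cover of `X̃_δ` (with the maximum metric inherited from `X × X`)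
such that `‖Φ(f)(x,y) - Φ(f)(ξ,η)‖ ≤ ε` for all `f ∈ A` whenever `(x,y)` and `(ξ,η)`
lie in the same member of the cover; here `Φ(f)(x,y) = (f x - f y)/φ(d(x,y))`. -/
theorem stmt_15 {X E : Type*} [MetricSpace X] [CompactSpace X]
    [NormedAddCommGroup E] [NormedSpace ℝ E]
    (φ : ℝ → ℝ) (hφ : IsCompFun φ)
    (A : Set (X → E)) (hA : A.Nonempty) (hAL : ∀ f ∈ A, MemLip φ f)
    (hbdd : ∃ M : ℝ, ∀ f ∈ A, bLipNorm φ f ≤ M)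
    (hsec : ∀ x : X, TotallyBounded ((fun f : X → E => f x) '' A))
    (δ : ℝ) (hδ : 0 < δ) :
    ∀ ε : ℝ, 0 < ε → ∃ (N : ℕ) (U : Fin N → Set (XtildeDelta X δ)),
      (∀ i, IsOpen (U i)) ∧ (⋃ i, U i) = Set.univ ∧
      ∀ i : Fin N, ∀ p ∈ U i, ∀ q ∈ U i, ∀ f ∈ A,
        ‖(φ (dist (p : X × X).1 (p : X × X).2))⁻¹ •
            (f (p : X × X).1 - f (p : X × X).2) -
          (φ (dist (q : X × X).1 (q : X × X).2))⁻¹ •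
            (f (q : X × X).1 - f (q : X × X).2)‖ ≤ ε := by
  intro ε hε
  obtain ⟨M, hM⟩ := hbdd
  have : CompactSpace (XtildeDelta X δ) :=
    isCompact_iff_compactSpace.1 (isClosed_XtildeDelta X δ).isCompact
  obtain ⟨N, U, hU, hcover, hosc⟩ := exists_finite_open_cover_of_equicontinuous
    (equicontinuous_differenceQuotient hφ
      (fun f hf => norm_sub_le_of_bLipNorm_le hφ (hAL f hf) (hM f hf)) hδ) hε
  refine ⟨N, U, hU, hcover, fun i p hp q hq f hf => ?_⟩
  rw [← dist_eq_norm]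
  exact hosc i p hp q hq ⟨f, hf⟩
end
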